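/- arXiv:2507.22682 — 2 statements merged into one kernel-verified Lean document; each statement's English description precedes it below -/
import Mathlib

section
/- Let L be a finite join-semidistributive lattice, M a maximal sublattice of L, and suppose the complement C = L \ M contains a coatom of L. Then C is an interval of L. -/
variable {L : Type*}

/-- `M` is a maximal sublattice of `L`: a proper sublattice such that the only
proper sublattice containing it is itself. -/
def IsMaxSublattice [Lattice L] (M : Set L) : Prop :=
  IsSublattice M ∧ M ≠ Set.univ ∧
    ∀ S : Set L, IsSublattice S → M ⊆ S → S ≠ Set.univ → S = M

/-- In a finite join-semidistributive lattice, if `c ⋖ a` then the elements of `Set.Iic a` not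
below `c` have a least element. -/
theorem exists_le_iff_not_le_of_covBy [Lattice L] [Fintype L]
    (hSD : ∀ x y z : L, x ⊔ y = x ⊔ z → x ⊔ (y ⊓ z) = x ⊔ y) {c a : L} (hca : c ⋖ a) :
    ∃ d ≤ a, ∀ x ≤ a, d ≤ x ↔ ¬ x ≤ c := by
  classical
  have hne : (Finset.univ.filter fun x : L => c ⊔ x = a).Nonempty :=
    ⟨a, by simp [hca.le]⟩
  have hd : c ⊔ (Finset.univ.filter fun x : L => c ⊔ x = a).inf' hne id = a :=
    Finset.inf'_induction hne id (p := fun x => c ⊔ x = a)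
      (fun x hx y hy => (hSD c x y (hx.trans hy.symm)).trans hx) (fun x hx => by simpa using hx)
  refine ⟨_, le_sup_right.trans_eq hd, fun x hx => ⟨fun hdx hxc => ?_, fun hxc => ?_⟩⟩
  · exact hca.lt.ne ((sup_eq_left.2 (hdx.trans hxc)).symm.trans hd)
  · have : c ⊔ x = a :=
      (hca.eq_or_eq le_sup_left (sup_le hca.le hx)).resolve_left fun h => hxc (sup_eq_left.1 h)
    exact Finset.inf'_le id (by simpa using this)

/-- A sup-closed set omitting `a` omits an interval `Set.Icc d a` with `d` join-prime in
`Set.Iic a`. -/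
theorem SupClosed.exists_joinPrime_Iic [Lattice L] [Fintype L]
    (hSD : ∀ x y z : L, x ⊔ y = x ⊔ z → x ⊔ (y ⊓ z) = x ⊔ y) {M : Set L} (hM : SupClosed M)
    {a : L} (ha : a ∉ M) :
    ∃ d ≤ a, (∀ x ∈ M, x ≤ a → ¬ d ≤ x) ∧
      ∀ x y, x ⊔ y ≤ a → d ≤ x ⊔ y → d ≤ x ∨ d ≤ y := by
  classical
  by_cases hne : (Finset.univ.filter fun x : L => x ∈ M ∧ x ≤ a).Nonempty
  · obtain ⟨hmM, hma⟩ :=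
      Finset.sup'_induction hne id (p := fun x => x ∈ M ∧ x ≤ a)
        (fun x hx y hy => ⟨hM hx.1 hy.1, sup_le hx.2 hy.2⟩) (fun x hx => by simpa using hx)
    obtain ⟨c, hmc, hca⟩ :=
      exists_le_covBy_of_lt (lt_of_le_of_ne hma fun h => ha (h ▸ hmM))
    obtain ⟨d, hda, hd⟩ := exists_le_iff_not_le_of_covBy hSD hca
    refine ⟨d, hda, fun x hxM hxa hdx => (hd x hxa).1 hdx ?_, fun x y hxy hdxy => ?_⟩
    · exact (Finset.le_sup' id (by simp [hxM, hxa])).trans hmc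
    · rw [hd _ hxy, sup_le_iff] at hdxy
      rw [hd x (le_sup_left.trans hxy), hd y (le_sup_right.trans hxy)]
      tauto
  · have : Nonempty L := ⟨a⟩
    obtain ⟨d, hd⟩ := Finite.exists_ge (id : L → L)
    refine ⟨d, hd a, fun x hxM hxa _ => hne ⟨x, by simp [hxM, hxa]⟩, fun x _ _ _ => .inl (hd x)⟩

theorem stmt13 [Lattice L] [Fintype L] [OrderTop L]
    (hSD : ∀ x y z : L, x ⊔ y = x ⊔ z → x ⊔ (y ⊓ z) = x ⊔ y)
    (M : Set L) (hM : IsMaxSublattice M)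
    (a : L) (ha : a ∈ Mᶜ) (hcoatom : a ⋖ ⊤) :
    ∃ d b : L, Mᶜ = Set.Icc d b := by
  obtain ⟨hsub, -, hmax⟩ := hM
  obtain ⟨p, -, hp⟩ := exists_le_iff_not_le_of_covBy hSD hcoatom
  obtain ⟨d, hda, hdM, hd⟩ := hsub.supClosed.exists_joinPrime_Iic hSD ha
  have key : (Set.Icc d a)ᶜ = M := by
    refine hmax _ ⟨fun x hx y hy hxy => ?_, fun x hx y hy hxy => ?_⟩
      (fun x hxM hx => hdM x hxM hx.2 hx.1)
      fun h => (h ▸ Set.mem_univ a : a ∈ (Set.Icc d a)ᶜ) ⟨hda, le_rfl⟩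
    · rcases hd x y hxy.2 hxy.1 with h | h
      · exact hx ⟨h, le_sup_left.trans hxy.2⟩
      · exact hy ⟨h, le_sup_right.trans hxy.2⟩
    · have hpx : p ≤ x := (hp x le_top).2 fun h => hx ⟨hxy.1.trans inf_le_left, h⟩
      have hpy : p ≤ y := (hp y le_top).2 fun h => hy ⟨hxy.1.trans inf_le_right, h⟩
      exact (hp _ le_top).1 (le_inf hpx hpy) hxy.2
  exact ⟨d, a, by rw [← key, compl_compl]⟩
end

section
/- Let L be a finite semidistributive lattice and M a maximal sublattice of L. If there is an element a in the complement C = L \ M that is comparable to every element of C, then C is an interval of L. -/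
variable {L : Type*}

theorem SupClosed.exists_isGreatest [Lattice L] [Finite L] {s : Set L} (hs : SupClosed s)
    (hne : s.Nonempty) : ∃ z, IsGreatest s z := by
  obtain ⟨x, hx⟩ := hne
  obtain ⟨z, -, hz⟩ := (Set.toFinite s).exists_le_maximal hx
  exact ⟨z, hz.prop, fun y hy => le_sup_right.trans (hz.le_of_ge (hs hz.prop hy) le_sup_left)⟩

theorem exists_minimal_notMem_le [Lattice L] [Finite L] {M : Set L} {c : L} (hc : c ∉ M) :
    ∃ p ≤ c, p ∉ M ∧ ∀ x ∉ M, x ≤ p → p ≤ x := by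
  obtain ⟨p, hpc, hp⟩ := (Set.toFinite Mᶜ).exists_le_minimal hc
  exact ⟨p, hpc, hp.prop, fun x hx hxp => hp.le_of_le hx hxp⟩

namespace IsMaxSublattice

variable [Lattice L] {M : Set L}

theorem sup_mem (hM : IsMaxSublattice M) {x y : L} (hx : x ∈ M) (hy : y ∈ M) : x ⊔ y ∈ M :=
  hM.1.supClosed hx hy

theorem inf_mem (hM : IsMaxSublattice M) {x y : L} (hx : x ∈ M) (hy : y ∈ M) : x ⊓ y ∈ M :=
  hM.1.infClosed hx hy

theorem not_isSublattice (hM : IsMaxSublattice M) {S : Set L} (hMS : M ⊆ S) {x y : L}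
    (hx : x ∉ M) (hxS : x ∈ S) (hy : y ∉ S) : ¬ IsSublattice S := fun hS =>
  hx (hM.2.2 S hS hMS (fun h => hy (h ▸ Set.mem_univ y)) ▸ hxS)

theorem dual (hM : IsMaxSublattice M) :
    IsMaxSublattice (L := Lᵒᵈ) (OrderDual.ofDual ⁻¹' M) := by
  refine ⟨⟨fun x hx y hy => hM.inf_mem hx hy, fun x hx y hy => hM.sup_mem hx hy⟩,
    fun h => hM.2.1 h, fun S hS hMS hne => ?_⟩
  exact hM.2.2 (OrderDual.toDual ⁻¹' S)
    ⟨fun x hx y hy => hS.infClosed hx hy, fun x hx y hy => hS.supClosed hx hy⟩ hMS hne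

/-- If `Mᶜ` meets `Set.Iic w` but is not contained in it, one leaves `Set.Iic w` within `Mᶜ` by
joining with a single element of `M`. -/
theorem exists_sup_notMem (hM : IsMaxSublattice M) {w y₀ c₀ : L} (hy₀ : y₀ ∉ M) (hyw : y₀ ≤ w)
    (hc₀ : c₀ ∉ M) (hcw : ¬ c₀ ≤ w) :
    ∃ y ≤ w, ∃ m ∈ M, y ⊔ m ∉ M ∧ ¬ y ⊔ m ≤ w := by
  by_contra! h
  refine hM.not_isSublattice (S := {x | x ∈ M ∨ x ≤ w}) (fun _ => Or.inl) hy₀ (Or.inr hyw)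
    (fun hc => hc.elim hc₀ hcw) ⟨?_, ?_⟩
  · rintro x (hx | hx) y (hy | hy)
    · exact Or.inl (hM.sup_mem hx hy)
    · rw [sup_comm]
      exact or_iff_not_imp_left.2 (h y hy x hx)
    · exact or_iff_not_imp_left.2 (h x hx y hy)
    · exact Or.inr (sup_le hx hy)
  · rintro x (hx | hx) y (hy | hy)
    · exact Or.inl (hM.inf_mem hx hy)
    · exact Or.inr (inf_le_right.trans hy)
    · exact Or.inr (inf_le_left.trans hx)
    · exact Or.inr (inf_le_left.trans hx)

theorem exists_inf_notMem (hM : IsMaxSublattice M) {w y₀ c₀ : L} (hy₀ : y₀ ∉ M) (hyw : w ≤ y₀)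
    (hc₀ : c₀ ∉ M) (hcw : ¬ w ≤ c₀) :
    ∃ y, w ≤ y ∧ ∃ m ∈ M, y ⊓ m ∉ M ∧ ¬ w ≤ y ⊓ m :=
  exists_sup_notMem (L := Lᵒᵈ) hM.dual hy₀ hyw hc₀ hcw

theorem compl_eq_Icc [Finite L] (hM : IsMaxSublattice M) {u v : L} (hu : IsLeast Mᶜ u)
    (hv : IsGreatest Mᶜ v) : Mᶜ = Set.Icc u v := by
  refine Set.Subset.antisymm (fun c hc => ⟨hu.2 hc, hv.2 hc⟩) fun m₀ hm₀ => ?_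
  by_contra hm₀M
  obtain ⟨m, -, hm⟩ := (Set.toFinite (M ∩ Set.Icc u v)).exists_le_minimal
    (show m₀ ∈ M ∩ Set.Icc u v from ⟨not_not.1 hm₀M, hm₀⟩)
  obtain ⟨hmM, hum, hmv⟩ := hm.prop
  have hmu : ¬ m ≤ u := fun h => hu.1 (le_antisymm h hum ▸ hmM)
  obtain ⟨x, hmx, m', hm', hxm, hnot⟩ := hM.exists_inf_notMem hv.1 hmv hu.1 hmu
  have hum' : u ≤ m' := (hu.2 hxm).trans inf_le_right
  have := hm.le_of_le ⟨hM.inf_mem hmM hm', le_inf hum hum', inf_le_left.trans hmv⟩ inf_le_left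
  exact hnot (le_inf hmx (this.trans inf_le_right))

variable {a z : L}

theorem exists_isGreatest_le [Finite L] (hM : IsMaxSublattice M) (h : ∃ m ∈ M, m ≤ a) :
    ∃ z, IsGreatest {m | m ∈ M ∧ m ≤ a} z :=
  SupClosed.exists_isGreatest
    (fun _ hx _ hy => ⟨hM.sup_mem hx.1 hy.1, sup_le hx.2 hy.2⟩) h

theorem exists_isLeast_ge [Finite L] (hM : IsMaxSublattice M) (h : ∃ m ∈ M, a ≤ m) :
    ∃ t, IsLeast {m | m ∈ M ∧ a ≤ m} t :=
  exists_isGreatest_le (L := Lᵒᵈ) hM.dual h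

theorem mem_of_le_isGreatest (hM : IsMaxSublattice M) (ha : a ∉ M)
    (hcomp : ∀ c ∉ M, a ≤ c ∨ c ≤ a) (hz : IsGreatest {m | m ∈ M ∧ m ≤ a} z) {x : L}
    (hx : x ≤ z) : x ∈ M := by
  by_contra hxM
  obtain ⟨⟨hzM, hza⟩, hz⟩ := hz
  have haz : ¬ a ≤ z := fun h => ha (le_antisymm h hza ▸ hzM)
  obtain ⟨y, hyz, m, hm, hym, hnot⟩ := hM.exists_sup_notMem hxM hx ha haz
  rcases hcomp _ hym with h | h
  · refine hym ?_
    have : y ⊔ m = z ⊔ m := le_antisymm (sup_le_sup_right hyz m)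
      (sup_le (hza.trans h) le_sup_right)
    exact this ▸ hM.sup_mem hzM hm
  · exact hnot (sup_le hyz (hz ⟨hm, le_sup_right.trans h⟩))

theorem mem_of_isLeast_le (hM : IsMaxSublattice M) (ha : a ∉ M)
    (hcomp : ∀ c ∉ M, a ≤ c ∨ c ≤ a) {t : L} (ht : IsLeast {m | m ∈ M ∧ a ≤ m} t) {x : L}
    (hx : t ≤ x) : x ∈ M :=
  mem_of_le_isGreatest (L := Lᵒᵈ) hM.dual ha (fun c hc => (hcomp c hc).symm) ht hx

theorem exists_sup_notMem_inf_notMem (hM : IsMaxSublattice M)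
    (hSDm : ∀ x y z : L, x ⊓ y = x ⊓ z → x ⊓ (y ⊔ z) = x ⊓ y) (ha : a ∉ M)
    (hcomp : ∀ c ∉ M, a ≤ c ∨ c ≤ a) (hz : IsGreatest {m | m ∈ M ∧ m ≤ a} z) {p q : L}
    (hp : p ∉ M) (hpa : p ≤ a) (hq : q ∉ M) (hqa : q ≤ a) (hqmin : ∀ x ∉ M, x ≤ q → q ≤ x)
    (hqp : ¬ q ≤ p ⊔ z) : ∃ m ∈ M, a ⊔ m ∉ M ∧ a ⊓ m ∉ M := by
  obtain ⟨y, hyw, m₀, hm₀, hym, hnot⟩ := hM.exists_sup_notMem hp le_sup_left hq hqp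
  have hlow : ∀ x ≤ z, x ∈ M := fun x hx => hM.mem_of_le_isGreatest ha hcomp hz hx
  obtain ⟨⟨hzM, hza⟩, hz⟩ := hz
  have hwa : p ⊔ z ≤ a := sup_le hpa hza
  have hay : a ≤ y ⊔ m₀ := (hcomp _ hym).resolve_right fun h =>
    hnot (sup_le hyw ((hz ⟨hm₀, le_sup_right.trans h⟩).trans le_sup_right))
  have key : ∀ b, p ⊔ z ≤ b → b ≤ a → b ⊔ (m₀ ⊔ z) = y ⊔ m₀ := fun b hb hba =>
    le_antisymm (sup_le (hba.trans hay) (sup_le le_sup_right (hza.trans hay)))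
      (sup_le_sup (hyw.trans hb) le_sup_left)
  refine ⟨m₀ ⊔ z, hM.sup_mem hm₀ hzM, by rwa [key a hwa le_rfl], fun hmem => hq (hlow q ?_)⟩
  have hmz : a ⊓ (m₀ ⊔ z) ≤ z := hz ⟨hmem, inf_le_left⟩
  have hw : q ⊓ (p ⊔ z) ∈ M := by
    by_contra h
    exact hqp ((hqmin _ h inf_le_left).trans inf_le_right)
  have h₁ : q ⊓ (p ⊔ z) = q ⊓ z := le_antisymm
    (le_inf inf_le_left (hz ⟨hw, inf_le_left.trans hqa⟩)) (inf_le_inf_left q le_sup_right)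
  have h₂ : q ⊓ (m₀ ⊔ z) = q ⊓ z := le_antisymm
    (le_inf inf_le_left ((inf_le_inf_right _ hqa).trans hmz)) (inf_le_inf_left q le_sup_right)
  have h := hSDm q _ _ (h₁.trans h₂.symm)
  rw [key _ le_rfl hwa, inf_eq_left.2 (hqa.trans hay), h₁] at h
  exact inf_eq_left.1 h.symm

theorem le_sup_of_isGreatest (hM : IsMaxSublattice M)
    (hSDm : ∀ x y z : L, x ⊓ y = x ⊓ z → x ⊓ (y ⊔ z) = x ⊓ y)
    (hz : IsGreatest {m | m ∈ M ∧ m ≤ a} z) {n l : L} (hn : n ∈ M) (hl : l ∈ M) (hzn : z ≤ n)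
    (hlle : ∀ m ∈ M, a ≤ m → l ≤ m) (hnl : n ⊓ l ≤ a)
    (hsplit : ∀ y, a ≤ y → l ≤ y ∨ y ⊓ l ≤ a) (hla : ¬ l ≤ a) {x m : L} (hxn : x ≤ n)
    (hm : m ∈ M) (hxm : a ≤ x ⊔ m) : l ≤ x ⊔ m := by
  refine (hsplit _ hxm).resolve_right fun hle => hla ?_
  obtain ⟨⟨hzM, hza⟩, hz⟩ := hz
  have hmz := hM.sup_mem hm hzM
  have h₁ : l ⊓ (m ⊔ z) ≤ a := by
    rw [inf_comm]
    exact (inf_le_inf_right l (sup_le le_sup_right (hza.trans hxm))).trans hle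
  have h₂ : l ⊓ (m ⊔ z) = l ⊓ z := le_antisymm
    (le_inf inf_le_left (hz ⟨hM.inf_mem hl hmz, h₁⟩)) (inf_le_inf_left l le_sup_right)
  have h₃ : l ⊓ n = l ⊓ z := le_antisymm
    (le_inf inf_le_left (hz ⟨hM.inf_mem hl hn, inf_comm n l ▸ hnl⟩)) (inf_le_inf_left l hzn)
  have h₄ : l ≤ m ⊔ z ⊔ n := hlle _ (hM.sup_mem hmz hn)
    (hxm.trans (sup_le (hxn.trans le_sup_right) (le_sup_left.trans le_sup_left)))
  have h := hSDm l _ _ (h₂.trans h₃.symm)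
  rw [inf_eq_left.2 h₄] at h
  exact h.le.trans h₁

theorem inf_le_of_isLeast (hM : IsMaxSublattice M)
    (hSDv : ∀ x y z : L, x ⊔ y = x ⊔ z → x ⊔ (y ⊓ z) = x ⊔ y) {t : L}
    (ht : IsLeast {m | m ∈ M ∧ a ≤ m} t) {n l : L} (hn : n ∈ M) (hl : l ∈ M) (hlt : l ≤ t)
    (hnge : ∀ m ∈ M, m ≤ a → m ≤ n) (hnl : a ≤ l ⊔ n)
    (hsplit : ∀ y, y ≤ a → y ≤ n ∨ a ≤ y ⊔ n) (han : ¬ a ≤ n) {x m : L} (hlx : l ≤ x)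
    (hm : m ∈ M) (hxm : x ⊓ m ≤ a) : x ⊓ m ≤ n :=
  le_sup_of_isGreatest (L := Lᵒᵈ) hM.dual hSDv ht hl hn hlt hnge hnl hsplit han hlx hm hxm

/-- The two elements `n` and `l` would make `M`, together with the elements of `Mᶜ` lying below
`a ⊓ n` or above `a ⊔ l`, a proper sublattice strictly containing `M`. -/
theorem false_of_separating (hM : IsMaxSublattice M)
    (hSDv : ∀ x y z : L, x ⊔ y = x ⊔ z → x ⊔ (y ⊓ z) = x ⊔ y)
    (hSDm : ∀ x y z : L, x ⊓ y = x ⊓ z → x ⊓ (y ⊔ z) = x ⊓ y) (ha : a ∉ M)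
    (hcomp : ∀ c ∉ M, a ≤ c ∨ c ≤ a) (hz : IsGreatest {m | m ∈ M ∧ m ≤ a} z) {t : L}
    (ht : IsLeast {m | m ∈ M ∧ a ≤ m} t) {n l : L} (hn : n ∈ M) (hl : l ∈ M) (hzn : z ≤ n)
    (hlt : l ≤ t) (hnl : n ⊓ l ≤ a) (hln : a ≤ l ⊔ n)
    (hsplitl : ∀ y, a ≤ y → l ≤ y ∨ y ⊓ l ≤ a) (hsplitn : ∀ y, y ≤ a → y ≤ n ∨ a ≤ y ⊔ n)
    (hla : ¬ l ≤ a) (han : ¬ a ≤ n) (hna : a ⊓ n ∉ M) : False := by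
  have hup : ∀ x ≤ n, ∀ m ∈ M, a ≤ x ⊔ m → l ≤ x ⊔ m := fun x hx m hm h =>
    hM.le_sup_of_isGreatest hSDm hz hn hl hzn (fun m hm ham => hlt.trans (ht.2 ⟨hm, ham⟩)) hnl
      hsplitl hla hx hm h
  have hdown : ∀ x, l ≤ x → ∀ m ∈ M, x ⊓ m ≤ a → x ⊓ m ≤ n := fun x hx m hm h =>
    hM.inf_le_of_isLeast hSDv ht hn hl hlt (fun m hm ham => (hz.2 ⟨hm, ham⟩).trans hzn) hln
      hsplitn han hx hm h
  have hsup : ∀ x ≤ a, x ≤ n → ∀ m ∈ M,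
      x ⊔ m ∈ M ∨ (x ⊔ m ≤ a ∧ x ⊔ m ≤ n) ∨ (a ≤ x ⊔ m ∧ l ≤ x ⊔ m) := by
    intro x hxa hxn m hm
    refine or_iff_not_imp_left.2 fun h => (hcomp _ h).symm.imp (fun h => ⟨h, ?_⟩)
      (fun h => ⟨h, hup x hxn m hm h⟩)
    exact sup_le hxn ((hz.2 ⟨hm, le_sup_right.trans h⟩).trans hzn)
  have hinf : ∀ x, a ≤ x → l ≤ x → ∀ m ∈ M,
      x ⊓ m ∈ M ∨ (x ⊓ m ≤ a ∧ x ⊓ m ≤ n) ∨ (a ≤ x ⊓ m ∧ l ≤ x ⊓ m) := by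
    intro x hax hlx m hm
    refine or_iff_not_imp_left.2 fun h => (hcomp _ h).symm.imp
      (fun h => ⟨h, hdown x hlx m hm h⟩) (fun h => ⟨h, ?_⟩)
    exact le_inf hlx (hlt.trans (ht.2 ⟨hm, h.trans inf_le_right⟩))
  have hsup' : ∀ x, a ≤ x → l ≤ x → ∀ y, a ≤ x ⊔ y ∧ l ≤ x ⊔ y := fun x hax hlx y =>
    ⟨hax.trans le_sup_left, hlx.trans le_sup_left⟩
  have hinf' : ∀ x, x ≤ a → x ≤ n → ∀ y, x ⊓ y ≤ a ∧ x ⊓ y ≤ n := fun x hxa hxn y =>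
    ⟨inf_le_left.trans hxa, inf_le_left.trans hxn⟩
  refine hM.not_isSublattice (S := {x | x ∈ M ∨ (x ≤ a ∧ x ≤ n) ∨ (a ≤ x ∧ l ≤ x)})
    (fun _ => Or.inl) hna (Or.inr (Or.inl ⟨inf_le_left, inf_le_right⟩)) (y := a) ?_ ⟨?_, ?_⟩
  · rintro (h | h | h)
    exacts [ha h, han h.2, hla h.2]
  · rintro x (hx | hx | hx) y (hy | hy | hy)
    · exact Or.inl (hM.sup_mem hx hy)
    · rw [sup_comm]; exact hsup y hy.1 hy.2 x hx
    · rw [sup_comm]; exact Or.inr (Or.inr (hsup' y hy.1 hy.2 x))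
    · exact hsup x hx.1 hx.2 y hy
    · exact Or.inr (Or.inl ⟨sup_le hx.1 hy.1, sup_le hx.2 hy.2⟩)
    · rw [sup_comm]; exact Or.inr (Or.inr (hsup' y hy.1 hy.2 x))
    all_goals exact Or.inr (Or.inr (hsup' x hx.1 hx.2 y))
  · rintro x (hx | hx | hx) y (hy | hy | hy)
    · exact Or.inl (hM.inf_mem hx hy)
    · rw [inf_comm]; exact Or.inr (Or.inl (hinf' y hy.1 hy.2 x))
    · rw [inf_comm]; exact hinf y hy.1 hy.2 x hx
    · exact Or.inr (Or.inl (hinf' x hx.1 hx.2 y))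
    · exact Or.inr (Or.inl (hinf' x hx.1 hx.2 y))
    · exact Or.inr (Or.inl (hinf' x hx.1 hx.2 y))
    · exact hinf x hx.1 hx.2 y hy
    · rw [inf_comm]; exact Or.inr (Or.inl (hinf' y hy.1 hy.2 x))
    · exact Or.inr (Or.inr ⟨le_inf hx.1 hy.1, le_inf hx.2 hy.2⟩)

/-- Either the least member of `M` above `a`, or the top element of `L` if there is none. -/
theorem exists_ge_inf_mem [Finite L] (hM : IsMaxSublattice M) (ha : a ∉ M)
    (hcomp : ∀ c ∉ M, a ≤ c ∨ c ≤ a) :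
    ∃ t, a ≤ t ∧ (∀ m ∈ M, a ≤ m → t ≤ m) ∧ (∀ m ∈ M, m ⊓ t ∈ M) ∧
      ∀ x, a ≤ x → x ∉ M → x ⊓ t ∉ M := by
  by_cases h : ∃ m ∈ M, a ≤ m
  · obtain ⟨t, ht⟩ := hM.exists_isLeast_ge h
    refine ⟨t, ht.1.2, fun m hm ham => ht.2 ⟨hm, ham⟩, fun m hm => hM.inf_mem hm ht.1.1,
      fun x hax hx hxt => hx (hM.mem_of_isLeast_le ha hcomp ht ?_)⟩
    exact (ht.2 ⟨hxt, le_inf hax ht.1.2⟩).trans inf_le_left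
  · obtain ⟨t, -, ht⟩ := SupClosed.exists_isGreatest (s := (Set.univ : Set L))
      (fun _ _ _ _ => Set.mem_univ _) ⟨a, Set.mem_univ a⟩
    have hinf : ∀ x, x ⊓ t = x := fun x => inf_eq_left.2 (ht (Set.mem_univ x))
    exact ⟨t, ht (Set.mem_univ a), fun m hm ham => (h ⟨m, hm, ham⟩).elim,
      fun m hm => by rwa [hinf], fun x _ hx => by rwa [hinf]⟩

theorem exists_inf_notMem_inf_le [Finite L] (hM : IsMaxSublattice M) (ha : a ∉ M)
    (hcomp : ∀ c ∉ M, a ≤ c ∨ c ≤ a) (hleast : ¬ ∃ u, IsLeast Mᶜ u) {n : L}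
    (han : a ⊔ n ∉ M) : ∃ l ∈ M, a ⊓ l ∉ M ∧ n ⊓ l ≤ a := by
  obtain ⟨t, hat, ht, htM, htC⟩ := hM.exists_ge_inf_mem ha hcomp
  have hv : (a ⊔ n) ⊓ t ∉ M := htC _ le_sup_left han
  obtain ⟨c, hc, hvc⟩ : ∃ c ∉ M, ¬ (a ⊔ n) ⊓ t ≤ c := by
    by_contra! h
    exact hleast ⟨_, hv, h⟩
  obtain ⟨x, hvx, m, hm, hxm, hnot⟩ := hM.exists_inf_notMem hv le_rfl hc hvc
  have hxa : x ⊓ m ≤ a := (hcomp _ hxm).resolve_left fun h =>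
    hnot (le_inf hvx (inf_le_right.trans (ht m hm (h.trans inf_le_right))))
  have hax : a ≤ x := (le_inf le_sup_left hat).trans hvx
  refine ⟨m ⊓ t, htM m hm, ?_, ?_⟩
  · have : a ⊓ (m ⊓ t) = x ⊓ m := le_antisymm
      (le_inf (inf_le_left.trans hax) (inf_le_right.trans inf_le_left))
      (le_inf hxa (le_inf inf_le_right (hxa.trans hat)))
    rwa [this]
  · refine le_trans (le_inf ?_ (inf_le_right.trans inf_le_left)) hxa
    exact le_trans (le_inf (inf_le_left.trans le_sup_right) (inf_le_right.trans inf_le_right)) hvx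

theorem exists_isLeast_compl [Finite L] (hM : IsMaxSublattice M)
    (hSDv : ∀ x y z : L, x ⊔ y = x ⊔ z → x ⊔ (y ⊓ z) = x ⊔ y)
    (hSDm : ∀ x y z : L, x ⊓ y = x ⊓ z → x ⊓ (y ⊔ z) = x ⊓ y) (ha : a ∉ M)
    (hcomp : ∀ c ∉ M, a ≤ c ∨ c ≤ a) : ∃ u, IsLeast Mᶜ u := by
  by_contra hleast
  obtain ⟨p, hpa, hp, hpmin⟩ := exists_minimal_notMem_le ha
  obtain ⟨c, hc, hpc⟩ : ∃ c ∉ M, ¬ p ≤ c := by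
    by_contra! h
    exact hleast ⟨p, hp, h⟩
  obtain ⟨q, hqc, hq, hqmin⟩ := exists_minimal_notMem_le hc
  have hpq : ¬ p ≤ q := fun h => hpc (h.trans hqc)
  have hqa : q ≤ a := (hcomp q hq).resolve_left fun h => hpq (hpa.trans h)
  have hpqM : p ⊓ q ∈ M := by
    by_contra h
    exact hpq ((hpmin _ h inf_le_left).trans inf_le_right)
  obtain ⟨z, hz⟩ := hM.exists_isGreatest_le ⟨p ⊓ q, hpqM, inf_le_left.trans hpa⟩
  have hlow : ∀ x ≤ z, x ∈ M := fun x hx => hM.mem_of_le_isGreatest ha hcomp hz hx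
  obtain ⟨m, hm, ham, ham'⟩ : ∃ m ∈ M, a ⊔ m ∉ M ∧ a ⊓ m ∉ M := by
    by_cases h₁ : q ≤ p ⊔ z
    · by_cases h₂ : p ≤ q ⊔ z
      · have h := hSDv z p q (le_antisymm (sup_le le_sup_left (sup_comm q z ▸ h₂))
          (sup_le le_sup_left (sup_comm p z ▸ h₁)))
        rw [sup_eq_left.2 (hz.2 ⟨hpqM, inf_le_left.trans hpa⟩)] at h
        exact (hp (hlow p (sup_eq_left.1 h.symm))).elim
      · exact hM.exists_sup_notMem_inf_notMem hSDm ha hcomp hz hq hqa hp hpa hpmin h₂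
    · exact hM.exists_sup_notMem_inf_notMem hSDm ha hcomp hz hp hpa hq hqa hqmin h₁
  obtain ⟨n, hmn, hnmax⟩ := (Set.toFinite {n | n ∈ M ∧ a ⊔ n ∉ M}).exists_le_maximal
    (show m ∈ {n | n ∈ M ∧ a ⊔ n ∉ M} from ⟨hm, ham⟩)
  obtain ⟨hn, han⟩ := hnmax.prop
  have hna : a ⊓ n ∉ M := fun h =>
    ham' (hlow _ ((inf_le_inf_left a hmn).trans (hz.2 ⟨h, inf_le_left⟩)))
  have hnlea : ¬ n ≤ a := fun h => hna (by rwa [inf_eq_right.2 h])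
  have halen : ¬ a ≤ n := fun h => han (by rwa [sup_eq_right.2 h])
  have hsplitn : ∀ x, x ≤ a → x ≤ n ∨ a ≤ x ⊔ n := by
    intro x hxa
    by_cases h : x ⊔ n ∈ M
    · have : a ⊔ (x ⊔ n) = a ⊔ n := by rw [← sup_assoc, sup_eq_left.2 hxa]
      exact Or.inl (le_sup_left.trans (hnmax.le_of_ge ⟨h, by rwa [this]⟩ le_sup_right))
    · exact Or.inr ((hcomp _ h).resolve_right fun h => hnlea (le_sup_right.trans h))
  obtain ⟨l₀, hl₀, hal₀, hnl₀⟩ := hM.exists_inf_notMem_inf_le ha hcomp hleast han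
  obtain ⟨l, hll₀, hlmin⟩ := (Set.toFinite {l | l ∈ M ∧ a ⊓ l ∉ M}).exists_le_minimal
    (show l₀ ∈ {l | l ∈ M ∧ a ⊓ l ∉ M} from ⟨hl₀, hal₀⟩)
  obtain ⟨hl, hal⟩ := hlmin.prop
  have hllea : ¬ l ≤ a := fun h => hal (by rwa [inf_eq_right.2 h])
  have hnl : n ⊓ l ≤ a := (inf_le_inf_left n hll₀).trans hnl₀
  have hal' : ¬ a ≤ l := fun h => by
    have : a ⊓ n = n ⊓ l :=
      le_antisymm (le_inf inf_le_right (inf_le_left.trans h)) (le_inf hnl inf_le_left)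
    exact hna (this ▸ hM.inf_mem hn hl)
  have hsplitl : ∀ y, a ≤ y → l ≤ y ∨ y ⊓ l ≤ a := by
    intro y hay
    by_cases h : y ⊓ l ∈ M
    · have : a ⊓ (y ⊓ l) = a ⊓ l := by rw [← inf_assoc, inf_eq_left.2 hay]
      exact Or.inl ((hlmin.le_of_le ⟨h, by rwa [this]⟩ inf_le_right).trans inf_le_left)
    · exact Or.inr ((hcomp _ h).resolve_left fun h => hal' (h.trans inf_le_right))
  have hln : a ≤ l ⊔ n := by
    rcases hsplitn (a ⊓ l) inf_le_left with h | h
    · have : a ⊓ l = n ⊓ l := le_antisymm (le_inf h inf_le_right) (le_inf hnl inf_le_right)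
      exact (hal (this ▸ hM.inf_mem hn hl)).elim
    · exact h.trans (sup_le_sup_right inf_le_right n)
  obtain ⟨t, ht⟩ := hM.exists_isLeast_ge ⟨l ⊔ n, hM.sup_mem hl hn, hln⟩
  have hzn : z ≤ n := (hsplitn z hz.1.2).resolve_right fun h => by
    have : a ⊔ n = z ⊔ n :=
      le_antisymm (sup_le h le_sup_right) (sup_le_sup_right hz.1.2 n)
    exact han (this ▸ hM.sup_mem hz.1.1 hn)
  have hlt : l ≤ t := (hsplitl t ht.1.2).resolve_right fun h => by
    have : a ⊓ l = t ⊓ l :=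
      le_antisymm (inf_le_inf_right l ht.1.2) (le_inf h inf_le_right)
    exact hal (this ▸ hM.inf_mem ht.1.1 hl)
  exact hM.false_of_separating hSDv hSDm ha hcomp hz ht hn hl hzn hlt hnl hln hsplitl hsplitn
    hllea halen hna

end IsMaxSublattice

theorem stmt17 [Lattice L] [Fintype L]
    (hSDv : ∀ x y z : L, x ⊔ y = x ⊔ z → x ⊔ (y ⊓ z) = x ⊔ y)
    (hSDm : ∀ x y z : L, x ⊓ y = x ⊓ z → x ⊓ (y ⊔ z) = x ⊓ y)
    (M : Set L) (hM : IsMaxSublattice M)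
    (a : L) (ha : a ∈ Mᶜ) (hcomp : ∀ c ∈ Mᶜ, a ≤ c ∨ c ≤ a) :
    ∃ u v : L, Mᶜ = Set.Icc u v := by
  obtain ⟨u, hu⟩ := hM.exists_isLeast_compl hSDv hSDm ha hcomp
  obtain ⟨v, hv⟩ : ∃ v, IsGreatest Mᶜ v :=
    IsMaxSublattice.exists_isLeast_compl (L := Lᵒᵈ) hM.dual hSDm hSDv ha
      fun c hc => (hcomp c hc).symm
  exact ⟨u, v, hM.compl_eq_Icc hu hv⟩
end
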